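/- For every integer n ≥ 1, the transitivity preserving projection of H_n over X'_n has exactly 2n+1 edges, and 2n+1 < 4n+1, so the TPP always has strictly fewer edges than the metagraph H_n it projects. -/

import Mathlib

/-- An edge of a metagraph: an invertex set and an outvertex set. -/
structure MEdge (α : Type*) where
  inv : Set α
  out : Set α

namespace MG

variable {α : Type*}

/-- `p` is a simple path from `x` to `y` using edges from `E`:
a nonempty sequence of edges of `E` with `x` in the invertex of the first edge,
`y` in the outvertex of the last edge, and consecutive edges sharing an element
(outvertex of one meets invertex of the next). -/
def IsSimplePath (E : Set (MEdge α)) (p : List (MEdge α)) (x y : α) : Prop :=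
  p ≠ [] ∧ (∀ e ∈ p, e ∈ E) ∧
  (∀ h : p ≠ [], x ∈ (p.head h).inv ∧ y ∈ (p.getLast h).out) ∧
  p.Chain' (fun e f => (e.out ∩ f.inv).Nonempty)

/-- Clauses (2) and (3) of the metapath definition: the pure inputs of `E'`
are contained in the source `B`, and the target `C` is covered by the union of
the outvertices. -/
def IsRelaxedMetapath (E : Set (MEdge α)) (B C : Set α) (E' : Set (MEdge α)) : Prop :=
  E' ⊆ E ∧
  ((⋃ e ∈ E', e.inv) \ (⋃ e ∈ E', e.out)) ⊆ B ∧
  C ⊆ ⋃ e ∈ E', e.out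

/-- Full metapath definition: clauses (2) and (3) together with clause (1),
that every edge of `E'` lies on a simple path (within `E'`) from some element
of `B` to some element of `C`. -/
def IsMetapath (E : Set (MEdge α)) (B C : Set α) (E' : Set (MEdge α)) : Prop :=
  IsRelaxedMetapath E B C E' ∧
  ∀ e ∈ E', ∃ (p : List (MEdge α)) (x y : α),
    x ∈ B ∧ y ∈ C ∧ e ∈ p ∧ IsSimplePath E' p x y

/-- Edge-dominance: no proper subset of `E'` is a metapath from `B` to `C`. -/
def IsEdgeDominant (E : Set (MEdge α)) (B C : Set α) (E' : Set (MEdge α)) : Prop :=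
  IsMetapath E B C E' ∧ ∀ F, F ⊂ E' → ¬ IsMetapath E B C F

/-- Input-dominance: there is no metapath from a proper subset of `B` to `C`. -/
def IsInputDominant (E : Set (MEdge α)) (B C : Set α) (E' : Set (MEdge α)) : Prop :=
  IsMetapath E B C E' ∧ ∀ B', B' ⊂ B → ∀ F, ¬ IsMetapath E B' C F

/-- Dominance: edge-dominant and input-dominant. -/
def IsDominant (E : Set (MEdge α)) (B C : Set α) (E' : Set (MEdge α)) : Prop :=
  IsEdgeDominant E B C E' ∧ IsInputDominant E B C E'

/-- Edge-dominance with respect to the relaxed metapath definition. -/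
def IsRelaxedEdgeDominant (E : Set (MEdge α)) (B C : Set α) (E' : Set (MEdge α)) : Prop :=
  IsRelaxedMetapath E B C E' ∧ ∀ F, F ⊂ E' → ¬ IsRelaxedMetapath E B C F

/-- Input-dominance with respect to the relaxed metapath definition. -/
def IsRelaxedInputDominant (E : Set (MEdge α)) (B C : Set α) (E' : Set (MEdge α)) : Prop :=
  IsRelaxedMetapath E B C E' ∧ ∀ B', B' ⊂ B → ∀ F, ¬ IsRelaxedMetapath E B' C F

/-- Dominance with respect to the relaxed metapath definition. -/
def IsRelaxedDominant (E : Set (MEdge α)) (B C : Set α) (E' : Set (MEdge α)) : Prop :=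
  IsRelaxedEdgeDominant E B C E' ∧ IsRelaxedInputDominant E B C E'

/-- Edge set of the Basu–Blanning projection of the metagraph with edge set `E`
over `X'`: for each invertex `V' ⊆ X'` of some dominant metapath `M(V',{x'})`
with `x' ∈ X'`, one edge `⟨V', W'⟩` where `W'` collects all such targets `x'`. -/
def BBP (E : Set (MEdge α)) (X' : Set α) : Set (MEdge α) :=
  { e | e.inv ⊆ X' ∧ (∃ x' ∈ X', ∃ M, IsDominant E e.inv {x'} M) ∧
        e.out = { x' | x' ∈ X' ∧ ∃ M, IsDominant E e.inv {x'} M } }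

/-- A metapath `M` with target `{x'}` is irreducible w.r.t. `X'` if no proper
subset of its edges forms a metapath `M(U,{x'})` with `U ⊆ X'`. -/
def Irreducible (E : Set (MEdge α)) (X' : Set α) (x' : α) (M : Set (MEdge α)) : Prop :=
  ¬ ∃ F, F ⊂ M ∧ ∃ U, U ⊆ X' ∧ IsMetapath E U {x'} F

/-- Edge set of the transitivity preserving projection of the metagraph with
edge set `E` over `X'`: as the Basu–Blanning projection, but collecting only
the irreducible dominant metapaths. -/
def TPP (E : Set (MEdge α)) (X' : Set α) : Set (MEdge α) :=
  { e | e.inv ⊆ X' ∧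
        (∃ x' ∈ X', ∃ M, IsDominant E e.inv {x'} M ∧ Irreducible E X' x' M) ∧
        e.out = { x' | x' ∈ X' ∧ ∃ M, IsDominant E e.inv {x'} M ∧ Irreducible E X' x' M } }

end MG

/-- Elements of the metagraphs `H_n`. -/
inductive Elt where
  | F0 : Elt
  | A : ℕ → Elt
  | B : ℕ → Elt
  | C : ℕ → Elt
  | D : ℕ → Elt
  | E : ℕ → Elt
deriving DecidableEq

/-- The generating set `X_n` of `H_n`. -/
def Xn (n : ℕ) : Set Elt :=
  {Elt.F0} ∪ {x | ∃ i ≤ n, x = Elt.A i ∨ x = Elt.B i} ∪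
    {x | ∃ i, 1 ≤ i ∧ i ≤ n ∧ (x = Elt.C i ∨ x = Elt.D i ∨ x = Elt.E i)}

/-- The edge set `E_n` of the metagraph `H_n`: the tail edge
`e_0 = ⟨{A_0,B_0},{F_0}⟩` together with, for each `1 ≤ i ≤ n`, the four edges
`e_{1,i} = ⟨{A_i},{C_i,D_i}⟩`, `e_{2,i} = ⟨{C_i},{A_{i-1}}⟩`,
`e_{3,i} = ⟨{B_i},{E_i}⟩`, `e_{4,i} = ⟨{D_i,E_i},{B_{i-1}}⟩`. -/
def En (n : ℕ) : Set (MEdge Elt) :=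
  {⟨{Elt.A 0, Elt.B 0}, {Elt.F0}⟩} ∪
  ⋃ i ∈ Set.Icc 1 n,
    ({⟨{Elt.A i}, {Elt.C i, Elt.D i}⟩,
      ⟨{Elt.C i}, {Elt.A (i - 1)}⟩,
      ⟨{Elt.B i}, {Elt.E i}⟩,
      ⟨{Elt.D i, Elt.E i}, {Elt.B (i - 1)}⟩} : Set (MEdge Elt))

/-- The projection set `X'_n = {A_i, B_i : 0 ≤ i ≤ n} ∪ {F_0}`. -/
def Xn' (n : ℕ) : Set Elt :=
  {Elt.F0} ∪ {x | ∃ i ≤ n, x = Elt.A i ∨ x = Elt.B i}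

namespace MG

variable {α : Type*}

theorem IsSimplePath.singleton {E : Set (MEdge α)} {e : MEdge α} {x y : α} (he : e ∈ E)
    (hx : x ∈ e.inv) (hy : y ∈ e.out) : IsSimplePath E [e] x y :=
  ⟨by simp, by simpa using he, fun _ => ⟨hx, hy⟩, List.isChain_singleton e⟩

theorem IsSimplePath.cons {E : Set (MEdge α)} {e : MEdge α} {p : List (MEdge α)} {x y z : α}
    (he : e ∈ E) (hx : x ∈ e.inv) (hy : y ∈ e.out) (hp : IsSimplePath E p y z) :
    IsSimplePath E (e :: p) x z := by
  obtain ⟨hne, hmem, hends, hchain⟩ := hp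
  refine ⟨by simp, by simpa using ⟨he, hmem⟩, fun _ => ⟨hx, ?_⟩, ?_⟩
  · rw [List.getLast_cons hne]
    exact (hends hne).2
  · cases p with
    | nil => exact absurd rfl hne
    | cons f q => exact List.isChain_cons_cons.2 ⟨⟨y, hy, (hends hne).1⟩, hchain⟩

/-- If a metapath `M` to `x` is contained in every metapath to `x` whose source lies in `X'`, and
its source `U` consists of pure inputs and cannot be shrunk, then `U` is the source of exactly the
irreducible dominant metapaths to `x`. -/
theorem exists_irreducible_dominant_iff {E : Set (MEdge α)} {X' U V : Set α} {x : α}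
    {M : Set (MEdge α)} (hU : U ⊆ X') (hM : IsMetapath E U {x} M)
    (hmin : ∀ U' ⊆ X', ∀ F, IsMetapath E U' {x} F → M ⊆ F)
    (hpure : U ⊆ (⋃ e ∈ M, e.inv) \ (⋃ e ∈ M, e.out))
    (hin : ∀ B, B ⊂ U → ∀ F, ¬ IsMetapath E B {x} F) (hV : V ⊆ X') :
    (∃ M', IsDominant E V {x} M' ∧ Irreducible E X' x M') ↔ V = U := by
  constructor
  · rintro ⟨M', ⟨⟨hM', -⟩, -, hin'⟩, hirr⟩
    obtain rfl : M = M' := by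
      by_contra hne
      exact hirr ⟨M, (hmin V hV M' hM').ssubset_of_ne hne, U, hU, hM⟩
    by_contra hne
    exact hin' U ((hpure.trans hM'.1.2.1).ssubset_of_ne (Ne.symm hne)) M hM
  · rintro rfl
    exact ⟨M, ⟨⟨hM, fun F hF hF' => hF.2 (hmin V hU F hF')⟩, hM, hin⟩,
      fun ⟨F, hF, U', hU', hF'⟩ => hF.2 (hmin U' hU' F hF')⟩

theorem IsMetapath.exists_edge_of_mem {E F : Set (MEdge α)} {U C : Set α} {x : α}
    (hF : IsMetapath E U C F) (hx : x ∈ C) : ∃ e ∈ F, x ∈ e.out := by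
  simpa using hF.1.2.2 hx

theorem IsMetapath.exists_edge_of_notMem {E F : Set (MEdge α)} {U C : Set α} {e : MEdge α}
    {x : α} (hF : IsMetapath E U C F) (he : e ∈ F) (hx : x ∈ e.inv) (hxU : x ∉ U) :
    ∃ f ∈ F, x ∈ f.out := by
  by_contra h
  refine hxU (hF.1.2.1 ⟨Set.mem_biUnion he hx, ?_⟩)
  simpa using h

end MG

open MG

/-- The edge of `H_n` producing a given element. -/
def producer : Elt → MEdge Elt
  | .F0 => ⟨{.A 0, .B 0}, {.F0}⟩
  | .A i => ⟨{.C (i + 1)}, {.A i}⟩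
  | .B i => ⟨{.D (i + 1), .E (i + 1)}, {.B i}⟩
  | .C i => ⟨{.A i}, {.C i, .D i}⟩
  | .D i => ⟨{.A i}, {.C i, .D i}⟩
  | .E i => ⟨{.B i}, {.E i}⟩

theorem mem_En {n : ℕ} {e : MEdge Elt} :
    e ∈ En n ↔ e = producer .F0 ∨ ∃ i < n, e = producer (.C (i + 1)) ∨ e = producer (.A i) ∨
      e = producer (.E (i + 1)) ∨ e = producer (.B i) := by
  simp only [En, Set.mem_union, Set.mem_singleton_iff, Set.mem_iUnion, Set.mem_insert_iff,
    producer, Set.mem_Icc]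
  refine or_congr_right ⟨?_, ?_⟩
  · rintro ⟨i, ⟨hi, hin⟩, h⟩
    obtain ⟨j, rfl⟩ := Nat.exists_eq_add_of_le' hi
    exact ⟨j, hin, by simpa using h⟩
  · rintro ⟨i, hi, h⟩
    exact ⟨i + 1, ⟨by omega, hi⟩, by simpa using h⟩

theorem eq_producer {n : ℕ} {e : MEdge Elt} {x : Elt} (he : e ∈ En n) (hx : x ∈ e.out) :
    e = producer x := by
  rcases mem_En.1 he with rfl | ⟨i, -, rfl | rfl | rfl | rfl⟩ <;>
    simp only [producer, Set.mem_insert_iff, Set.mem_singleton_iff] at hx <;>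
    rcases hx with rfl | rfl <;> rfl

theorem producer_A_mem {n i : ℕ} : producer (.A i) ∈ En n ↔ i < n := by
  refine ⟨fun h => ?_, fun h => mem_En.2 (.inr ⟨i, h, by simp⟩)⟩
  have hx : .A i ∈ (producer (.A i)).out := rfl
  rcases mem_En.1 h with h | ⟨j, hj, h | h | h | h⟩ <;> rw [h] at hx <;>
    simp [producer] at hx
  omega

theorem producer_B_mem {n i : ℕ} : producer (.B i) ∈ En n ↔ i < n := by
  refine ⟨fun h => ?_, fun h => mem_En.2 (.inr ⟨i, h, by simp⟩)⟩
  have hx : .B i ∈ (producer (.B i)).out := rfl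
  rcases mem_En.1 h with h | ⟨j, hj, h | h | h | h⟩ <;> rw [h] at hx <;>
    simp [producer] at hx
  omega

namespace MG.IsMetapath

variable {n : ℕ} {U C : Set Elt} {F : Set (MEdge Elt)}

theorem producer_mem_of_mem {x : Elt} (hF : IsMetapath (En n) U C F) (hx : x ∈ C) :
    producer x ∈ F := by
  obtain ⟨e, he, hxe⟩ := hF.exists_edge_of_mem hx
  exact eq_producer (hF.1.1 he) hxe ▸ he

theorem producer_mem_of_notMem {e : MEdge Elt} {x : Elt} (hF : IsMetapath (En n) U C F)
    (he : e ∈ F) (hx : x ∈ e.inv) (hxU : x ∉ U) : producer x ∈ F := by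
  obtain ⟨f, hf, hxf⟩ := hF.exists_edge_of_notMem he hx hxU
  exact eq_producer (hF.1.1 hf) hxf ▸ hf

theorem A_mem_source {e : MEdge Elt} {i : ℕ} (hF : IsMetapath (En n) U C F)
    (hU : U ⊆ {.A i, .B i}) (he : e ∈ F) (hi : .A i ∈ e.inv) : .A i ∈ U := by
  by_contra h
  have key : ∀ k, producer (.A (i + k)) ∈ F := by
    intro k
    induction k with
    | zero => exact hF.producer_mem_of_notMem he hi h
    | succ k ih =>
      have hC : producer (.C (i + k + 1)) ∈ F :=
        hF.producer_mem_of_notMem ih (by simp [producer]) (fun hm => by simpa using hU hm)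
      exact hF.producer_mem_of_notMem hC (by simp [producer]; rfl)
        (fun hm => by simpa using hU hm)
  have := producer_A_mem.1 (hF.1.1 (key n))
  omega

theorem B_mem_source {e : MEdge Elt} {i : ℕ} (hF : IsMetapath (En n) U C F)
    (hU : U ⊆ {.A i, .B i}) (he : e ∈ F) (hi : .B i ∈ e.inv) : .B i ∈ U := by
  by_contra h
  have key : ∀ k, producer (.B (i + k)) ∈ F := by
    intro k
    induction k with
    | zero => exact hF.producer_mem_of_notMem he hi h
    | succ k ih =>
      have hE : producer (.E (i + k + 1)) ∈ F :=
        hF.producer_mem_of_notMem ih (by simp [producer]) (fun hm => by simpa using hU hm)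
      exact hF.producer_mem_of_notMem hE (by simp [producer]; rfl)
        (fun hm => by simpa using hU hm)
  have := producer_B_mem.1 (hF.1.1 (key n))
  omega

end MG.IsMetapath

variable {n : ℕ} {V : Set Elt}

theorem exists_irreducible_dominant_F0_iff (hV : V ⊆ Xn' n) :
    (∃ M, IsDominant (En n) V {.F0} M ∧ Irreducible (En n) (Xn' n) .F0 M) ↔
      V = {.A 0, .B 0} := by
  refine exists_irreducible_dominant_iff (M := {producer .F0}) ?_ ⟨⟨?_, ?_, ?_⟩, ?_⟩ ?_ ?_ ?_ hV
  · rintro x (rfl | rfl) <;> simp [Xn']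
  · simpa using mem_En.2 (.inl rfl)
  · simp [producer]
  · simp [producer]
  · rintro e rfl
    exact ⟨[producer .F0], .A 0, .F0, by simp, rfl, by simp,
      .singleton rfl (by simp [producer]) (by simp [producer])⟩
  · rintro U - F hF e rfl
    exact hF.producer_mem_of_mem rfl
  · rintro x (rfl | rfl) <;> simp [producer]
  · rintro B hB F hF
    have h := hF.producer_mem_of_mem rfl
    refine hB.2 ?_
    rintro x (rfl | rfl)
    · exact hF.A_mem_source hB.1 h (by simp [producer])
    · exact hF.B_mem_source hB.1 h (by simp [producer])

theorem exists_irreducible_dominant_A_iff {i : ℕ} (hi : i < n) (hV : V ⊆ Xn' n) :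
    (∃ M, IsDominant (En n) V {.A i} M ∧ Irreducible (En n) (Xn' n) (.A i) M) ↔
      V = {.A (i + 1)} := by
  have hmin : ∀ U ⊆ Xn' n, ∀ F, IsMetapath (En n) U {.A i} F →
      {producer (.A i), producer (.C (i + 1))} ⊆ F := by
    intro U hU F hF
    have hA : producer (.A i) ∈ F := hF.producer_mem_of_mem rfl
    rintro e (rfl | rfl)
    · exact hA
    · exact hF.producer_mem_of_notMem hA (by simp [producer])
        (fun hm => by simpa [Xn'] using hU hm)
  have hX : {.A (i + 1)} ⊆ Xn' n := by
    rintro x rfl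
    simp [Xn']
    omega
  refine exists_irreducible_dominant_iff hX ⟨⟨?_, ?_, ?_⟩, ?_⟩ hmin ?_ ?_ hV
  · rintro e (rfl | rfl) <;> exact mem_En.2 (.inr ⟨i, hi, by simp⟩)
  · rintro x ⟨hx, hx'⟩
    simp [producer] at hx hx'
    grind
  · simp [producer]
  · have hA : IsSimplePath {producer (.A i), producer (.C (i + 1))} [producer (.A i)]
        (.C (i + 1)) (.A i) := .singleton (.inl rfl) rfl rfl
    intro e he
    refine ⟨_, .A (i + 1), .A i, rfl, rfl, ?_, hA.cons (.inr rfl) rfl (.inl rfl)⟩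
    rcases he with rfl | rfl <;> simp
  · rintro x rfl
    simp [producer]
  · intro B hB F hF
    have h := hmin B (hB.1.trans hX) F hF (.inr rfl)
    refine hB.2 ?_
    rintro x rfl
    exact hF.A_mem_source (hB.1.trans (by simp)) h rfl

theorem exists_irreducible_dominant_B_iff {i : ℕ} (hi : i < n) (hV : V ⊆ Xn' n) :
    (∃ M, IsDominant (En n) V {.B i} M ∧ Irreducible (En n) (Xn' n) (.B i) M) ↔
      V = {.A (i + 1), .B (i + 1)} := by
  have hmin : ∀ U ⊆ Xn' n, ∀ F, IsMetapath (En n) U {.B i} F →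
      {producer (.B i), producer (.D (i + 1)), producer (.E (i + 1))} ⊆ F := by
    intro U hU F hF
    have hB : producer (.B i) ∈ F := hF.producer_mem_of_mem rfl
    rintro e (rfl | rfl | rfl)
    · exact hB
    · exact hF.producer_mem_of_notMem (x := .D (i + 1)) hB (by simp [producer])
        (fun hm => by simpa [Xn'] using hU hm)
    · exact hF.producer_mem_of_notMem (x := .E (i + 1)) hB (by simp [producer])
        (fun hm => by simpa [Xn'] using hU hm)
  have hX : {.A (i + 1), .B (i + 1)} ⊆ Xn' n := by
    rintro x (rfl | rfl) <;> simp [Xn'] <;> omega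
  refine exists_irreducible_dominant_iff hX ⟨⟨?_, ?_, ?_⟩, ?_⟩ hmin ?_ ?_ hV
  · rintro e (rfl | rfl | rfl) <;> exact mem_En.2 (.inr ⟨i, hi, by simp [producer]⟩)
  · rintro x ⟨hx, hx'⟩
    simp [producer] at hx hx'
    grind
  · simp [producer]
  · have hB {x : Elt} (hx : x ∈ (producer (.B i)).inv) :
        IsSimplePath {producer (.B i), producer (.D (i + 1)), producer (.E (i + 1))}
          [producer (.B i)] x (.B i) := .singleton (.inl rfl) hx rfl
    have hD := (hB (.inl rfl)).cons (e := producer (.D (i + 1))) (x := .A (i + 1))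
      (.inr (.inl rfl)) rfl (.inr rfl)
    have hE := (hB (.inr rfl)).cons (e := producer (.E (i + 1))) (x := .B (i + 1))
      (.inr (.inr rfl)) rfl rfl
    rintro e (rfl | rfl | rfl)
    · exact ⟨_, _, _, .inl rfl, rfl, by simp, hD⟩
    · exact ⟨_, _, _, .inl rfl, rfl, by simp, hD⟩
    · exact ⟨_, _, _, .inr rfl, rfl, by simp, hE⟩
  · rintro x (rfl | rfl) <;> simp [producer]
  · intro B hB F hF
    have h := hmin B (hB.1.trans hX) F hF
    refine hB.2 ?_
    rintro x (rfl | rfl)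
    · exact hF.A_mem_source hB.1 (h (.inr (.inl rfl))) rfl
    · exact hF.B_mem_source hB.1 (h (.inr (.inr rfl))) rfl

/-- The source of the irreducible dominant metapaths to a given element of the projection set. -/
def irreducibleSource : Elt → Set Elt
  | .F0 => {.A 0, .B 0}
  | .A i => {.A (i + 1)}
  | .B i => {.A (i + 1), .B (i + 1)}
  | _ => ∅

theorem irreducibleSource_subset {x : Elt}
    (hx : x = .F0 ∨ ∃ i < n, x = .A i ∨ x = .B i) : irreducibleSource x ⊆ Xn' n := by
  rcases hx with rfl | ⟨i, hi, rfl | rfl⟩ <;> intro y hy <;>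
    simp [irreducibleSource] at hy <;> simp [Xn'] <;> grind

theorem mem_and_exists_irreducible_dominant_iff {x : Elt} (hV : V ⊆ Xn' n) :
    (x ∈ Xn' n ∧ ∃ M, IsDominant (En n) V {x} M ∧ Irreducible (En n) (Xn' n) x M) ↔
      (x = .F0 ∨ ∃ i < n, x = .A i ∨ x = .B i) ∧ V = irreducibleSource x := by
  constructor
  · rintro ⟨hx, h⟩
    rcases hx with rfl | ⟨i, -, rfl | rfl⟩
    · exact ⟨.inl rfl, (exists_irreducible_dominant_F0_iff hV).1 h⟩
    · have hi : i < n := by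
        obtain ⟨M, hM, -⟩ := h
        exact producer_A_mem.1 (hM.1.1.1.1 (hM.1.1.producer_mem_of_mem rfl))
      exact ⟨.inr ⟨i, hi, .inl rfl⟩, (exists_irreducible_dominant_A_iff hi hV).1 h⟩
    · have hi : i < n := by
        obtain ⟨M, hM, -⟩ := h
        exact producer_B_mem.1 (hM.1.1.1.1 (hM.1.1.producer_mem_of_mem rfl))
      exact ⟨.inr ⟨i, hi, .inr rfl⟩, (exists_irreducible_dominant_B_iff hi hV).1 h⟩
  · rintro ⟨rfl | ⟨i, hi, rfl | rfl⟩, h⟩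
    · exact ⟨.inl rfl, (exists_irreducible_dominant_F0_iff hV).2 h⟩
    · exact ⟨.inr ⟨i, hi.le, .inl rfl⟩, (exists_irreducible_dominant_A_iff hi hV).2 h⟩
    · exact ⟨.inr ⟨i, hi.le, .inr rfl⟩, (exists_irreducible_dominant_B_iff hi hV).2 h⟩

theorem irreducibleSource_inj {x y : Elt} (hx : x = .F0 ∨ ∃ i < n, x = .A i ∨ x = .B i)
    (hy : y = .F0 ∨ ∃ i < n, y = .A i ∨ y = .B i)
    (h : irreducibleSource x = irreducibleSource y) : x = y := by
  have hA (j : ℕ) : .A j ∈ irreducibleSource x ↔ .A j ∈ irreducibleSource y := by rw [h]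
  have hB (j : ℕ) : .B j ∈ irreducibleSource x ↔ .B j ∈ irreducibleSource y := by rw [h]
  rcases hx with rfl | ⟨i, -, rfl | rfl⟩ <;> rcases hy with rfl | ⟨j, -, rfl | rfl⟩
  · rfl
  · simpa [irreducibleSource] using hB 0
  · simpa [irreducibleSource] using hA 0
  · simpa [irreducibleSource] using hB 0
  · simpa [irreducibleSource] using hA (i + 1)
  · simpa [irreducibleSource] using hB (j + 1)
  · simpa [irreducibleSource] using hA 0
  · simpa [irreducibleSource] using hB (i + 1)
  · simpa [irreducibleSource] using hA (i + 1)

/-- The elements other than `A_n` and `B_n` of the projection set. -/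
def irreducibleTargets (n : ℕ) : Finset Elt :=
  {.F0} ∪ (Finset.range n).image .A ∪ (Finset.range n).image .B

theorem mem_irreducibleTargets {x : Elt} :
    x ∈ irreducibleTargets n ↔ x = .F0 ∨ ∃ i < n, x = .A i ∨ x = .B i := by
  simp [irreducibleTargets]
  grind

theorem TPP_En_eq_image :
    TPP (En n) (Xn' n) =
      (fun x => ⟨irreducibleSource x, {x}⟩) '' (irreducibleTargets n : Set Elt) := by
  have hout {x : Elt} (hx : x ∈ irreducibleTargets n) :
      {y | y ∈ Xn' n ∧ ∃ M, IsDominant (En n) (irreducibleSource x) {y} M ∧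
        Irreducible (En n) (Xn' n) y M} = {x} := by
    rw [mem_irreducibleTargets] at hx
    ext y
    rw [Set.mem_ofPred_eq, mem_and_exists_irreducible_dominant_iff (irreducibleSource_subset hx)]
    refine ⟨fun ⟨hy, h⟩ => (irreducibleSource_inj hx hy h).symm, ?_⟩
    rintro rfl
    exact ⟨hx, rfl⟩
  ext ⟨V, W⟩
  constructor
  · rintro ⟨hV, ⟨x, hx, hM⟩, hW⟩
    obtain ⟨hx', rfl⟩ := (mem_and_exists_irreducible_dominant_iff hV).1 ⟨hx, hM⟩
    rw [← mem_irreducibleTargets] at hx'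
    exact ⟨x, hx', congrArg (MEdge.mk _) ((hout hx').symm.trans hW.symm)⟩
  · rintro ⟨x, hx, h⟩
    obtain ⟨rfl, rfl⟩ := MEdge.mk.inj h
    have hx' := mem_irreducibleTargets.1 hx
    have hV := irreducibleSource_subset hx'
    obtain ⟨hxX, hM⟩ := (mem_and_exists_irreducible_dominant_iff hV).2 ⟨hx', rfl⟩
    exact ⟨hV, ⟨x, hxX, hM⟩, (hout hx).symm⟩

theorem card_irreducibleTargets : (irreducibleTargets n).card = 2 * n + 1 := by
  rw [irreducibleTargets, Finset.card_union_of_disjoint, Finset.card_union_of_disjoint,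
    Finset.card_image_of_injective, Finset.card_image_of_injective]
  · simp
    omega
  all_goals first
    | exact fun _ _ h => by simpa using h
    | (simp [Finset.disjoint_left]; try grind)

/-- One output of each edge of `H_n`. -/
def producedElements (n : ℕ) : Finset Elt :=
  irreducibleTargets n ∪ ((Finset.Icc 1 n).image .C ∪ (Finset.Icc 1 n).image .E)

theorem En_eq_image : En n = producer '' (producedElements n : Set Elt) := by
  ext e
  simp only [mem_En, producedElements, Set.mem_image, Finset.mem_coe, Finset.mem_union,
    mem_irreducibleTargets, Finset.mem_image, Finset.mem_Icc]
  constructor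
  · rintro (rfl | ⟨i, hi, rfl | rfl | rfl | rfl⟩)
    · exact ⟨_, .inl (.inl rfl), rfl⟩
    · exact ⟨_, .inr (.inl ⟨i + 1, ⟨by omega, hi⟩, rfl⟩), rfl⟩
    · exact ⟨_, .inl (.inr ⟨i, hi, .inl rfl⟩), rfl⟩
    · exact ⟨_, .inr (.inr ⟨i + 1, ⟨by omega, hi⟩, rfl⟩), rfl⟩
    · exact ⟨_, .inl (.inr ⟨i, hi, .inr rfl⟩), rfl⟩
  · rintro ⟨x, (rfl | ⟨i, hi, rfl | rfl⟩) | ⟨i, ⟨hi, hin⟩, rfl⟩ | ⟨i, ⟨hi, hin⟩, rfl⟩, rfl⟩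
    · exact .inl rfl
    · exact .inr ⟨i, hi, by simp⟩
    · exact .inr ⟨i, hi, by simp⟩
    · exact .inr ⟨i - 1, by omega, .inl (by rw [Nat.sub_add_cancel hi])⟩
    · exact .inr ⟨i - 1, by omega, .inr (.inr (.inl (by rw [Nat.sub_add_cancel hi])))⟩

theorem injOn_producer : Set.InjOn producer (producedElements n : Set Elt) := by
  intro x hx y hy h
  have hxy : x ∈ (producer y).out := by
    rw [← h]
    cases x <;> simp [producer]
  have hx : ∀ i, x ≠ .D i := by
    rintro i rfl
    simp [producedElements, irreducibleTargets] at hx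
  have hy : ∀ i, y ≠ .D i := by
    rintro i rfl
    simp [producedElements, irreducibleTargets] at hy
  cases y <;> simp [producer] at hxy <;> grind

theorem card_producedElements : (producedElements n).card = 4 * n + 1 := by
  rw [producedElements, Finset.card_union_of_disjoint, Finset.card_union_of_disjoint,
    Finset.card_image_of_injective, Finset.card_image_of_injective, card_irreducibleTargets]
  · simp
    omega
  all_goals first
    | exact fun _ _ h => by simpa using h
    | (simp [Finset.disjoint_left, irreducibleTargets]; try grind)

theorem ncard_TPP_En : (TPP (En n) (Xn' n)).ncard = 2 * n + 1 := by
  rw [TPP_En_eq_image, Set.ncard_image_of_injective, Set.ncard_coe_finset,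
    card_irreducibleTargets]
  exact fun x y h => Set.singleton_injective (MEdge.mk.inj h).2

theorem ncard_En : (En n).ncard = 4 * n + 1 := by
  rw [En_eq_image, injOn_producer.ncard_image, Set.ncard_coe_finset,
    card_producedElements]

/-- For every `n ≥ 1`, the transitivity preserving projection of `H_n` over
`X'_n` has exactly `2n + 1` edges, and `2n + 1 < 4n + 1`, so the TPP has
strictly fewer edges than `H_n`. -/
theorem stmt_8 (n : ℕ) (hn : 1 ≤ n) :
    (MG.TPP (En n) (Xn' n)).ncard = 2 * n + 1 ∧
    2 * n + 1 < 4 * n + 1 ∧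
    (MG.TPP (En n) (Xn' n)).ncard < (En n).ncard := by
  rw [ncard_TPP_En, ncard_En]
  omega
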